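/- Let n ≥ 3 be an integer, let D ⊂ ℝⁿ be a bounded open set with smooth boundary, and let w be a smooth positive function on a neighborhood of the closure of D with R[w] > 0 on the closure of D. Assume λ₁(D,w) > (sup_{x ∈ D} R[w](x))/(n−1). Let u be a smooth positive function on the closure of D such that: (i) R[w·u](x) ≥ R[w](x) for every x ∈ D; (ii) u = 1 on ∂D; (iii) ∂u/∂ν = 0 on ∂D, where ν is the outward unit normal. Then u ≡ 1 on D; equivalently, the conformal metric (w·u)^{4/(n−2)}·δ coincides with w^{4/(n−2)}·δ on D. -/

import Mathlib

open MeasureTheory Real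

/-- The Euclidean Laplacian of a function `u : ℝⁿ → ℝ`. -/
noncomputable def lap {n : ℕ} (u : EuclideanSpace ℝ (Fin n) → ℝ)
    (x : EuclideanSpace ℝ (Fin n)) : ℝ :=
  ∑ i : Fin n, fderiv ℝ (fun y => fderiv ℝ u y (EuclideanSpace.single i 1)) x
    (EuclideanSpace.single i 1)

/-- The scalar curvature `R[U] = -(4(n-1)/(n-2)) U^{-(n+2)/(n-2)} ΔU` of the
conformally flat metric `U^{4/(n-2)}·δ`. -/
noncomputable def Rcurv (n : ℕ) (U : EuclideanSpace ℝ (Fin n) → ℝ)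
    (x : EuclideanSpace ℝ (Fin n)) : ℝ :=
  -(4 * ((n : ℝ) - 1) / ((n : ℝ) - 2)) *
    (U x) ^ (-(((n : ℝ) + 2) / ((n : ℝ) - 2))) * lap U x

/-- `D` has smooth boundary, with outward unit normal field `ν` on `∂D`. -/
def SmoothBoundaryNormal {n : ℕ} (D : Set (EuclideanSpace ℝ (Fin n)))
    (ν : EuclideanSpace ℝ (Fin n) → EuclideanSpace ℝ (Fin n)) : Prop :=
  ∃ f : EuclideanSpace ℝ (Fin n) → ℝ, ContDiff ℝ (⊤ : ℕ∞) f ∧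
    D = {x | f x < 0} ∧ frontier D = {x | f x = 0} ∧
    ∀ x ∈ frontier D, gradient f x ≠ 0 ∧ ν x = ‖gradient f x‖⁻¹ • gradient f x

/-- The first Dirichlet eigenvalue `λ₁(D, w)` of the Laplace–Beltrami operator of the
metric `w^{4/(n-2)}·δ` on `D`, as the infimum of the Rayleigh quotient over nonzero
smooth compactly supported test functions in `D`. -/
noncomputable def lam1 (n : ℕ) (D : Set (EuclideanSpace ℝ (Fin n)))
    (w : EuclideanSpace ℝ (Fin n) → ℝ) : ℝ :=
  sInf { q : ℝ | ∃ φ : EuclideanSpace ℝ (Fin n) → ℝ, ContDiff ℝ (⊤ : ℕ∞) φ ∧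
    HasCompactSupport φ ∧ tsupport φ ⊆ D ∧ φ ≠ 0 ∧
    q = (∫ x in D, (w x) ^ 2 * ‖gradient φ x‖ ^ 2) /
        (∫ x in D, (w x) ^ ((2 * (n : ℝ)) / ((n : ℝ) - 2)) * (φ x) ^ 2) }

open Filter Topology Set

/-- The `i`-th partial derivative of a function on `ℝⁿ`. -/
noncomputable def partialD {n : ℕ} (i : Fin n) (u : EuclideanSpace ℝ (Fin n) → ℝ)
    (x : EuclideanSpace ℝ (Fin n)) : ℝ :=
  fderiv ℝ u x (EuclideanSpace.single i 1)

/-- The inner product of the gradients of two functions on `ℝⁿ`. -/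
noncomputable def gradDot {n : ℕ} (u v : EuclideanSpace ℝ (Fin n) → ℝ)
    (x : EuclideanSpace ℝ (Fin n)) : ℝ :=
  ∑ i : Fin n, partialD i u x * partialD i v x

/-- The weighted Laplacian `div (a ∇v)`. -/
noncomputable def wdiv {n : ℕ} (a v : EuclideanSpace ℝ (Fin n) → ℝ)
    (x : EuclideanSpace ℝ (Fin n)) : ℝ :=
  ∑ i : Fin n, partialD i (fun y => a y * partialD i v y) x

section Calculus

variable {n : ℕ} {u v w a : EuclideanSpace ℝ (Fin n) → ℝ} {x : EuclideanSpace ℝ (Fin n)}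

theorem ContDiff.partialD (hu : ContDiff ℝ (⊤ : ℕ∞) u) (i : Fin n) :
    ContDiff ℝ (⊤ : ℕ∞) (partialD i u) :=
  (hu.fderiv_right (m := (⊤ : ℕ∞)) (by simp)).clm_apply contDiff_const

theorem ContDiff.gradDot (hu : ContDiff ℝ (⊤ : ℕ∞) u) (hv : ContDiff ℝ (⊤ : ℕ∞) v) :
    ContDiff ℝ (⊤ : ℕ∞) (gradDot u v) :=
  ContDiff.sum fun i _ => (hu.partialD i).mul (hv.partialD i)

theorem ContDiff.wdiv (ha : ContDiff ℝ (⊤ : ℕ∞) a) (hv : ContDiff ℝ (⊤ : ℕ∞) v) :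
    ContDiff ℝ (⊤ : ℕ∞) (wdiv a v) :=
  ContDiff.sum fun i _ => (ha.mul (hv.partialD i)).partialD i

theorem ContDiff.lap (hu : ContDiff ℝ (⊤ : ℕ∞) u) : ContDiff ℝ (⊤ : ℕ∞) (lap u) :=
  ContDiff.sum fun i _ => (hu.partialD i).partialD i

theorem partialD_congr (h : u =ᶠ[𝓝 x] v) (i : Fin n) : partialD i u x = partialD i v x := by
  simp only [partialD, h.fderiv_eq]

theorem lap_congr (h : u =ᶠ[𝓝 x] v) : lap u x = lap v x := by
  refine Finset.sum_congr rfl fun i _ => ?_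
  have : (fun y => fderiv ℝ u y (EuclideanSpace.single i 1)) =ᶠ[𝓝 x]
      fun y => fderiv ℝ v y (EuclideanSpace.single i 1) :=
    h.eventuallyEq_nhds.mono fun y hy => partialD_congr hy i
  rw [this.fderiv_eq]

theorem Rcurv_congr (h : u =ᶠ[𝓝 x] v) : Rcurv n u x = Rcurv n v x := by
  simp only [Rcurv, lap_congr h, h.eq_of_nhds]

theorem partialD_mul (hu : DifferentiableAt ℝ u x) (hv : DifferentiableAt ℝ v x) (i : Fin n) :
    partialD i (fun y => u y * v y) x = u x * partialD i v x + v x * partialD i u x := by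
  simp only [partialD]
  rw [fderiv_fun_mul hu hv]
  simp

theorem partialD_comp {g : ℝ → ℝ} (hg : DifferentiableAt ℝ g (u x))
    (hu : DifferentiableAt ℝ u x) (i : Fin n) :
    partialD i (fun y => g (u y)) x = deriv g (u x) * partialD i u x := by
  have := (hg.hasDerivAt.comp_hasFDerivAt x hu.hasFDerivAt).fderiv
  simp only [partialD]
  rw [show (fun y => g (u y)) = g ∘ u from rfl, this]
  simp

theorem gradDot_comp {g : ℝ → ℝ} (hg : DifferentiableAt ℝ g (u x))
    (hu : DifferentiableAt ℝ u x) :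
    gradDot (fun y => g (u y)) v x = deriv g (u x) * gradDot u v x := by
  simp only [gradDot, partialD_comp hg hu, Finset.mul_sum, mul_assoc]

theorem gradDot_self_comp {g : ℝ → ℝ} (hg : DifferentiableAt ℝ g (u x))
    (hu : DifferentiableAt ℝ u x) :
    gradDot (fun y => g (u y)) (fun y => g (u y)) x = deriv g (u x) ^ 2 * gradDot u u x := by
  simp only [gradDot, partialD_comp hg hu, Finset.mul_sum]
  exact Finset.sum_congr rfl fun i _ => by ring

theorem gradient_apply_eq_partialD (i : Fin n) : gradient u x i = partialD i u x := by
  have := inner_gradient_left (𝕜 := ℝ) (f := u) (x := x) (y := EuclideanSpace.single i (1 : ℝ))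
  rw [EuclideanSpace.inner_single_right] at this
  simpa [partialD] using this

theorem norm_gradient_sq : ‖gradient u x‖ ^ 2 = gradDot u u x := by
  rw [EuclideanSpace.norm_sq_eq]
  refine Finset.sum_congr rfl fun i _ => ?_
  rw [gradient_apply_eq_partialD, Real.norm_eq_abs, sq_abs, sq]

theorem fderiv_apply_gradient : fderiv ℝ v x (gradient u x) = gradDot u v x := by
  rw [← inner_gradient_left (𝕜 := ℝ), PiLp.inner_apply]
  refine Finset.sum_congr rfl fun i _ => ?_
  simp [gradient_apply_eq_partialD]

/-- The conformal change formula `div (w² ∇u) = w Δ(wu) - u w Δw`. -/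
theorem wdiv_sq_eq (hw : ContDiff ℝ (⊤ : ℕ∞) w) (hu : ContDiff ℝ (⊤ : ℕ∞) u) :
    wdiv (fun y => w y ^ 2) u x =
      w x * lap (fun y => w y * u y) x - u x * w x * lap w x := by
  have dw := hw.differentiable (by simp)
  have du := hu.differentiable (by simp)
  have key : ∀ i : Fin n, partialD i (fun y => w y ^ 2 * partialD i u y) x =
      w x * partialD i (partialD i (fun y => w y * u y)) x
        - u x * w x * partialD i (partialD i w) x := by
    intro i
    have dwi := (hw.partialD i).differentiable (by simp)
    have dui := (hu.partialD i).differentiable (by simp)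
    have e1 : partialD i (fun y => w y * u y) =
        fun y => w y * partialD i u y + u y * partialD i w y :=
      funext fun y => partialD_mul (dw y) (du y) i
    have e2 : partialD i (fun y => w y * partialD i u y + u y * partialD i w y) x =
        partialD i (fun y => w y * partialD i u y) x
          + partialD i (fun y => u y * partialD i w y) x := by
      have := fderiv_add ((dw x).mul (dui x)) ((du x).mul (dwi x))
      exact congrArg (fun L => L (EuclideanSpace.single i 1)) this
    have e3 : partialD i (fun y => w y ^ 2) x = 2 * w x * partialD i w x := by
      simp only [sq]
      rw [partialD_mul (dw x) (dw x)]
      ring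
    rw [e1, e2, partialD_mul (dw x) (dui x), partialD_mul (du x) (dwi x),
      partialD_mul (u := fun y => w y ^ 2) ((dw x).pow 2) (dui x), e3]
    ring
  have l1 : lap (fun y => w y * u y) x =
      ∑ i, partialD i (partialD i (fun y => w y * u y)) x := rfl
  have l2 : lap w x = ∑ i, partialD i (partialD i w) x := rfl
  rw [l1, l2, wdiv, Finset.mul_sum, Finset.mul_sum, ← Finset.sum_sub_distrib]
  exact Finset.sum_congr rfl fun i _ => key i

end Calculus

/-- A function smooth near a closed set agrees near that set with a globally smooth one. -/
theorem exists_contDiff_eventuallyEq {n : ℕ} {K V : Set (EuclideanSpace ℝ (Fin n))}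
    (hK : IsClosed K) (hV : IsOpen V) (hKV : K ⊆ V) {u : EuclideanSpace ℝ (Fin n) → ℝ}
    (hu : ContDiffOn ℝ (⊤ : ℕ∞) u V) :
    ∃ u' : EuclideanSpace ℝ (Fin n) → ℝ, ContDiff ℝ (⊤ : ℕ∞) u' ∧ ∀ x ∈ K, u' =ᶠ[𝓝 x] u := by
  obtain ⟨χ, h0, h1, -⟩ := exists_contMDiffMap_zero_one_nhds_of_isClosed (n := (⊤ : ℕ∞))
    (modelWithCornersSelf ℝ (EuclideanSpace ℝ (Fin n))) hV.isClosed_compl hK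
    (disjoint_compl_left_iff_subset.2 hKV)
  rw [eventually_nhdsSet_iff_forall] at h0 h1
  have hχ : ContDiff ℝ (⊤ : ℕ∞) χ := χ.contMDiff.contDiff
  refine ⟨fun x => χ x * u x, contDiff_iff_contDiffAt.2 fun x => ?_, fun x hx => ?_⟩
  · by_cases hx : x ∈ V
    · exact hχ.contDiffAt.mul (hu.contDiffAt (hV.mem_nhds hx))
    · refine (contDiffAt_const (c := (0 : ℝ))).congr_of_eventuallyEq ?_
      filter_upwards [h0 x hx] with y hy
      simp [hy]
  · filter_upwards [h1 x hx] with y hy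
    simp [hy]

section Indicator

variable {n : ℕ} {D : Set (EuclideanSpace ℝ (Fin n))} {F : EuclideanSpace ℝ (Fin n) → ℝ}

theorem indicator_eventuallyEq_zero (hF : ∀ x ∈ frontier D, F =ᶠ[𝓝 x] 0) (hD : IsOpen D)
    {x : EuclideanSpace ℝ (Fin n)} (hx : x ∉ D) : D.indicator F =ᶠ[𝓝 x] 0 := by
  by_cases hxc : x ∈ closure D
  · have : x ∈ frontier D := by rw [hD.frontier_eq]; exact ⟨hxc, hx⟩
    filter_upwards [hF x this] with y hy
    by_cases h : y ∈ D <;> simp [h, hy]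
  · filter_upwards [isClosed_closure.isOpen_compl.mem_nhds hxc] with y hy
    exact indicator_of_notMem (fun h => hy (subset_closure h)) _

theorem indicator_eventuallyEq_self (hD : IsOpen D)
    {x : EuclideanSpace ℝ (Fin n)} (hx : x ∈ D) : D.indicator F =ᶠ[𝓝 x] F := by
  filter_upwards [hD.mem_nhds hx] with y hy
  exact indicator_of_mem hy _

theorem ContDiff.indicator_of_frontier (hFs : ContDiff ℝ (⊤ : ℕ∞) F)
    (hF : ∀ x ∈ frontier D, F =ᶠ[𝓝 x] 0) (hD : IsOpen D) :
    ContDiff ℝ (⊤ : ℕ∞) (D.indicator F) := by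
  refine contDiff_iff_contDiffAt.2 fun x => ?_
  by_cases hx : x ∈ D
  · exact hFs.contDiffAt.congr_of_eventuallyEq (indicator_eventuallyEq_self hD hx)
  · exact (contDiffAt_const (c := (0 : ℝ))).congr_of_eventuallyEq
      (indicator_eventuallyEq_zero hF hD hx)

theorem tsupport_indicator_subset_of_frontier (hF : ∀ x ∈ frontier D, F =ᶠ[𝓝 x] 0)
    (hD : IsOpen D) : tsupport (D.indicator F) ⊆ D := by
  intro x hx
  by_contra h
  exact (notMem_tsupport_iff_eventuallyEq.2 (indicator_eventuallyEq_zero hF hD h)) hx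

theorem hasCompactSupport_indicator (hb : Bornology.IsBounded D) :
    HasCompactSupport (D.indicator F) :=
  HasCompactSupport.intro hb.isCompact_closure fun _ hx =>
    indicator_of_notMem (fun h => hx (subset_closure h)) _

end Indicator

theorem Continuous.integrableOn_of_isBounded {n : ℕ} {D : Set (EuclideanSpace ℝ (Fin n))}
    (hb : Bornology.IsBounded D) {h : EuclideanSpace ℝ (Fin n) → ℝ} (hc : Continuous h) :
    IntegrableOn h D :=
  (hc.continuousOn.integrableOn_compact hb.isCompact_closure).mono_set subset_closure

/-- Green's formula against a function vanishing near the boundary. -/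
theorem integral_mul_wdiv_eq_neg {n : ℕ} {D : Set (EuclideanSpace ℝ (Fin n))}
    {a v F : EuclideanSpace ℝ (Fin n) → ℝ} (hD : IsOpen D) (hb : Bornology.IsBounded D)
    (ha : ContDiff ℝ (⊤ : ℕ∞) a) (hv : ContDiff ℝ (⊤ : ℕ∞) v) (hFs : ContDiff ℝ (⊤ : ℕ∞) F)
    (hF : ∀ x ∈ frontier D, F =ᶠ[𝓝 x] 0) :
    ∫ x in D, F x * wdiv a v x = -∫ x in D, a x * gradDot F v x := by
  set G := D.indicator F with hGdef
  have hG : ContDiff ℝ (⊤ : ℕ∞) G := hFs.indicator_of_frontier hF hD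
  have hGc : HasCompactSupport G := hasCompactSupport_indicator hb
  have hY : ∀ i, ContDiff ℝ (⊤ : ℕ∞) (fun y => a y * partialD i v y) :=
    fun i => ha.mul (hv.partialD i)
  have hGc' : ∀ i, HasCompactSupport (partialD i G) := fun i =>
    hGc.fderiv_apply (𝕜 := ℝ) (EuclideanSpace.single i 1)
  have I1 : ∀ i, Integrable fun x => G x * partialD i (fun y => a y * partialD i v y) x :=
    fun i => (hG.continuous.mul ((hY i).partialD i).continuous).integrable_of_hasCompactSupport
      hGc.mul_right
  have I2 : ∀ i, Integrable fun x => partialD i G x * (a x * partialD i v x) :=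
    fun i => ((hG.partialD i).continuous.mul (hY i).continuous).integrable_of_hasCompactSupport
      (hGc' i).mul_right
  have I3 : ∀ i, Integrable fun x => G x * (a x * partialD i v x) :=
    fun i => (hG.continuous.mul (hY i).continuous).integrable_of_hasCompactSupport hGc.mul_right
  have parts : ∀ i, ∫ x, G x * partialD i (fun y => a y * partialD i v y) x =
      -∫ x, partialD i G x * (a x * partialD i v x) := fun i =>
    integral_mul_fderiv_eq_neg_fderiv_mul_of_integrable (I2 i) (I1 i) (I3 i)
      (fun x _ => hG.differentiable (by simp) x) (fun x _ => (hY i).differentiable (by simp) x)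
  have L : ∫ x in D, F x * wdiv a v x = ∫ x, G x * wdiv a v x := by
    rw [← integral_indicator hD.measurableSet]
    congr 1
    ext x
    by_cases hx : x ∈ D <;> simp [hGdef, hx]
  have R : ∫ x in D, a x * gradDot F v x = ∫ x, a x * gradDot G v x := by
    rw [← integral_indicator hD.measurableSet]
    congr 1
    ext x
    by_cases hx : x ∈ D
    · simp only [indicator_of_mem hx, gradDot,
        fun i => partialD_congr (indicator_eventuallyEq_self (F := F) hD hx) i, hGdef]
    · have h0 : ∀ i, partialD i G x = 0 := fun i => by
        rw [partialD_congr (indicator_eventuallyEq_zero hF hD hx) i]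
        simp [partialD]
      simp [gradDot, h0, hx]
  rw [L, R]
  have e1 : ∀ x, G x * wdiv a v x =
      ∑ i, G x * partialD i (fun y => a y * partialD i v y) x := fun x => by
    rw [wdiv, Finset.mul_sum]
  have e2 : ∀ x, a x * gradDot G v x = ∑ i, partialD i G x * (a x * partialD i v x) := fun x => by
    rw [gradDot, Finset.mul_sum]
    exact Finset.sum_congr rfl fun i _ => by ring
  simp only [e1, e2]
  rw [integral_finsetSum _ fun i _ => I1 i, integral_finsetSum _ fun i _ => I2 i,
    ← Finset.sum_neg_distrib]
  exact Finset.sum_congr rfl fun i _ => parts i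

theorem ContinuousOn.integrableOn_of_isBounded {n : ℕ} {D : Set (EuclideanSpace ℝ (Fin n))}
    (hb : Bornology.IsBounded D) {h : EuclideanSpace ℝ (Fin n) → ℝ}
    (hc : ContinuousOn h (closure D)) : IntegrableOn h D :=
  (hc.integrableOn_compact hb.isCompact_closure).mono_set subset_closure

/-- A function vanishing on the boundary of a domain with a regular defining function is bounded
by a multiple of that defining function. -/
theorem exists_abs_le_mul_abs_of_frontier {n : ℕ} {D : Set (EuclideanSpace ℝ (Fin n))}
    {f h : EuclideanSpace ℝ (Fin n) → ℝ} (hb : Bornology.IsBounded D)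
    (hf : ContDiff ℝ (⊤ : ℕ∞) f) (hh : ContDiff ℝ (⊤ : ℕ∞) h) (hD : D = {x | f x < 0})
    (hfr : frontier D = {x | f x = 0}) (hgrad : ∀ x ∈ frontier D, gradient f x ≠ 0)
    (h0 : ∀ x ∈ frontier D, h x = 0) :
    ∃ C, ∀ x ∈ D, |h x| ≤ C * |f x| := by
  suffices H : ∀ x ∈ closure D, ∃ C, ∀ᶠ y in 𝓝 x, y ∈ D → |h y| ≤ C * |f y| by
    have key : ∃ C, ∀ y ∈ closure D, y ∈ D → |h y| ≤ C * |f y| := by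
      refine hb.isCompact_closure.induction_on
        (p := fun s => ∃ C, ∀ y ∈ s, y ∈ D → |h y| ≤ C * |f y|) ?_ ?_ ?_ ?_
      · exact ⟨0, by simp⟩
      · rintro s t hst ⟨C, hC⟩
        exact ⟨C, fun y hy => hC y (hst hy)⟩
      · rintro s t ⟨C, hC⟩ ⟨C', hC'⟩
        refine ⟨max C C', fun y hy hyD => ?_⟩
        rcases hy with hy | hy
        · exact (hC y hy hyD).trans
            (mul_le_mul_of_nonneg_right (le_max_left _ _) (abs_nonneg _))
        · exact (hC' y hy hyD).trans
            (mul_le_mul_of_nonneg_right (le_max_right _ _) (abs_nonneg _))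
      · intro x hx
        obtain ⟨C, hC⟩ := H x hx
        exact ⟨_, mem_nhdsWithin_of_mem_nhds hC, C, fun y hy => hy⟩
    obtain ⟨C, hC⟩ := key
    exact ⟨C, fun x hx => hC x (subset_closure hx) hx⟩
  intro x₀ hx₀
  by_cases hxD : x₀ ∈ D
  · have hfx : f x₀ < 0 := by rw [hD] at hxD; exact hxD
    have hlt : |h x₀| < (|h x₀| + 1) / |f x₀| * |f x₀| := by
      rw [div_mul_cancel₀ _ (abs_ne_zero.2 hfx.ne)]
      exact lt_add_one _
    refine ⟨(|h x₀| + 1) / |f x₀|, ?_⟩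
    have c1 : Continuous fun y => |h y| := hh.continuous.abs
    have c2 : Continuous fun y => (|h x₀| + 1) / |f x₀| * |f y| :=
      continuous_const.mul hf.continuous.abs
    filter_upwards [c1.continuousAt.eventually_lt c2.continuousAt hlt] with y hy _
    exact hy.le
  · have hDo : IsOpen D := by rw [hD]; exact isOpen_lt hf.continuous continuous_const
    have hxf : x₀ ∈ frontier D := by rw [hDo.frontier_eq]; exact ⟨hx₀, hxD⟩
    have hfx : f x₀ = 0 := by rw [hfr] at hxf; exact hxf
    set e := gradient f x₀ with he
    have hepos : 0 < ‖e‖ := norm_pos_iff.2 (hgrad x₀ hxf)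
    have hfe : fderiv ℝ f x₀ e = ‖e‖ ^ 2 := by
      rw [← inner_gradient_left (𝕜 := ℝ), ← he, real_inner_self_eq_norm_sq]
    have sf := hf.contDiffAt.hasStrictFDerivAt (x := x₀) (by simp)
    have sh := hh.contDiffAt.hasStrictFDerivAt (x := x₀) (by simp)
    obtain ⟨L, s, hs, hL⟩ := sh.exists_lipschitzOnWith
    have hlo := sf.isLittleO.def (half_pos hepos)
    rw [nhds_prod_eq] at hlo
    obtain ⟨t, ht, hft⟩ := Filter.mem_prod_same_iff.1 hlo
    obtain ⟨r, hr, hball⟩ := Metric.mem_nhds_iff.1 (Filter.inter_mem hs ht)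
    set τ : EuclideanSpace ℝ (Fin n) → ℝ := fun y => |f y| * (2 / ‖e‖ ^ 2) with hτ
    have hτc : Continuous fun y => dist y x₀ + τ y * ‖e‖ :=
      (continuous_id.dist continuous_const).add
        ((hf.continuous.abs.mul continuous_const).mul continuous_const)
    have hsmall : ∀ᶠ y in 𝓝 x₀, dist y x₀ + τ y * ‖e‖ < r :=
      hτc.continuousAt.eventually_lt continuousAt_const (by simp [hτ, hfx, hr])
    refine ⟨L * (2 / ‖e‖ ^ 2) * ‖e‖, ?_⟩
    filter_upwards [hsmall] with y hy hyD
    have hfy : f y < 0 := by rw [hD] at hyD; exact hyD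
    have hτ0 : 0 ≤ τ y := mul_nonneg (abs_nonneg _) (by positivity)
    have hmem : ∀ σ ∈ Icc (0 : ℝ) (τ y), y + σ • e ∈ s ∩ t := by
      intro σ hσ
      refine hball ?_
      rw [Metric.mem_ball]
      calc dist (y + σ • e) x₀ ≤ dist (y + σ • e) y + dist y x₀ := dist_triangle _ _ _
        _ = σ * ‖e‖ + dist y x₀ := by
          rw [dist_self_add_left, norm_smul, Real.norm_of_nonneg hσ.1]
        _ ≤ τ y * ‖e‖ + dist y x₀ := by gcongr; exact hσ.2
        _ < r := by linarith
    have hy0 : y ∈ s ∩ t := by simpa using hmem 0 ⟨le_rfl, hτ0⟩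
    have hend : 0 ≤ f (y + τ y • e) := by
      have h1 := hft (mk_mem_prod (hmem (τ y) ⟨hτ0, le_rfl⟩).2 hy0.2)
      simp only [mem_ofPred_eq, add_sub_cancel_left, map_smul, hfe, smul_eq_mul, norm_smul,
        Real.norm_eq_abs, abs_of_nonneg hτ0] at h1
      have h2 := (abs_le.1 h1).1
      have h3 : τ y * ‖e‖ ^ 2 = 2 * |f y| := by
        simp only [hτ]; field_simp
      have h4 : |f y| = -f y := abs_of_neg hfy
      nlinarith
    have hcont : ContinuousOn (fun σ : ℝ => f (y + σ • e)) (Icc 0 (τ y)) :=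
      (hf.continuous.comp (by fun_prop)).continuousOn
    obtain ⟨σ, hσ, hσ0⟩ := intermediate_value_Icc hτ0 hcont
      (show (0 : ℝ) ∈ Icc _ _ from ⟨by simpa using hfy.le, hend⟩)
    have hz : h (y + σ • e) = 0 := h0 _ (by rw [hfr]; exact hσ0)
    have hlip := hL.dist_le_mul _ hy0.1 _ (hmem σ hσ).1
    rw [hz, Real.dist_eq, sub_zero, dist_self_add_right, norm_smul,
      Real.norm_of_nonneg hσ.1] at hlip
    calc |h y| ≤ L * (σ * ‖e‖) := hlip
      _ ≤ L * (τ y * ‖e‖) := by gcongr; exact hσ.2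
      _ = L * (2 / ‖e‖ ^ 2) * ‖e‖ * |f y| := by simp only [hτ]; ring

/-- A smooth step function: `0` for `y ≤ 1` and `1` for `2 ≤ y`. -/
noncomputable def cutoff (y : ℝ) : ℝ := smoothTransition (y - 1)

section Cutoff

theorem contDiff_cutoff : ContDiff ℝ (⊤ : ℕ∞) cutoff :=
  smoothTransition.contDiff.comp (contDiff_id.sub contDiff_const)

theorem cutoff_nonneg (y : ℝ) : 0 ≤ cutoff y := smoothTransition.nonneg _

theorem cutoff_le_one (y : ℝ) : cutoff y ≤ 1 := smoothTransition.le_one _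

theorem cutoff_eq_zero {y : ℝ} (h : y ≤ 1) : cutoff y = 0 :=
  smoothTransition.zero_of_nonpos (by linarith)

theorem cutoff_eq_one {y : ℝ} (h : 2 ≤ y) : cutoff y = 1 :=
  smoothTransition.one_of_one_le (by linarith)

theorem deriv_cutoff_of_lt {y : ℝ} (h : y < 1) : deriv cutoff y = 0 := by
  have : cutoff =ᶠ[𝓝 y] fun _ => 0 := by
    filter_upwards [Iio_mem_nhds h] with z hz using cutoff_eq_zero (le_of_lt hz)
  rw [this.deriv_eq, deriv_const]

theorem deriv_cutoff_of_gt {y : ℝ} (h : 2 < y) : deriv cutoff y = 0 := by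
  have : cutoff =ᶠ[𝓝 y] fun _ => 1 := by
    filter_upwards [Ioi_mem_nhds h] with z hz using cutoff_eq_one (le_of_lt hz)
  rw [this.deriv_eq, deriv_const]

theorem exists_abs_mul_deriv_cutoff_le : ∃ C, 0 ≤ C ∧ ∀ y, |y * deriv cutoff y| ≤ C := by
  have hc : Continuous fun y => |y * deriv cutoff y| :=
    (continuous_id.mul (contDiff_cutoff.continuous_deriv (by simp))).abs
  obtain ⟨C, hC⟩ := (isCompact_Icc (a := (1 : ℝ)) (b := 2)).bddAbove_image hc.continuousOn
  have hC0 : 0 ≤ C := (abs_nonneg _).trans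
    (hC (mem_image_of_mem _ (left_mem_Icc.2 (by norm_num : (1 : ℝ) ≤ 2))))
  refine ⟨C, hC0, fun y => ?_⟩
  rcases lt_or_ge y 1 with h | h
  · simpa [deriv_cutoff_of_lt h] using hC0
  rcases lt_or_ge 2 y with h' | h'
  · simpa [deriv_cutoff_of_gt h'] using hC0
  exact hC (mem_image_of_mem _ ⟨h, h'⟩)

/-- For negative `t`, the scaled argument of the cutoff is eventually beyond the transition. -/
theorem eventually_two_lt_scaled {t : ℝ} (ht : t < 0) :
    ∀ᶠ k : ℕ in atTop, 2 < -(((k : ℝ) + 1) * t) := by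
  obtain ⟨N, hN⟩ := exists_nat_gt (2 / -t)
  filter_upwards [eventually_ge_atTop N] with k hk
  have hk' : (N : ℝ) ≤ k := by exact_mod_cast hk
  have h1 : 2 / -t < (k : ℝ) + 1 := by linarith
  rw [div_lt_iff₀ (by linarith)] at h1
  linarith

end Cutoff

/-- If `a ∂_ν v` vanishes on the boundary, then `∫ div (a ∇v) = 0`. -/
theorem integral_wdiv_eq_zero {n : ℕ} {D : Set (EuclideanSpace ℝ (Fin n))}
    {a v f : EuclideanSpace ℝ (Fin n) → ℝ} (hDo : IsOpen D) (hb : Bornology.IsBounded D)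
    (ha : ContDiff ℝ (⊤ : ℕ∞) a) (hv : ContDiff ℝ (⊤ : ℕ∞) v) (hf : ContDiff ℝ (⊤ : ℕ∞) f)
    (hD : D = {x | f x < 0}) (hfr : frontier D = {x | f x = 0})
    (hgrad : ∀ x ∈ frontier D, gradient f x ≠ 0) (hn : ∀ x ∈ frontier D, gradDot f v x = 0) :
    ∫ x in D, wdiv a v x = 0 := by
  have hh : ContDiff ℝ (⊤ : ℕ∞) fun x => a x * gradDot f v x := ha.mul (hf.gradDot hv)
  obtain ⟨C, hC⟩ := exists_abs_le_mul_abs_of_frontier hb hf hh hD hfr hgrad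
    (fun x hx => by simp [hn x hx])
  obtain ⟨C', -, hC'⟩ := exists_abs_mul_deriv_cutoff_le
  let g : ℕ → ℝ → ℝ := fun k t => cutoff (-(((k : ℝ) + 1) * t))
  have hg : ∀ k, ContDiff ℝ (⊤ : ℕ∞) (g k) := fun k =>
    contDiff_cutoff.comp (contDiff_const.mul contDiff_id).neg
  have hg' : ∀ k t, deriv (g k) t =
      -(((k : ℝ) + 1) * deriv cutoff (-(((k : ℝ) + 1) * t))) := by
    intro k t
    have h1 : HasDerivAt (fun s : ℝ => -(((k : ℝ) + 1) * s)) (-(((k : ℝ) + 1) * 1)) t :=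
      ((hasDerivAt_id t).const_mul _).neg
    have h2 := ((contDiff_cutoff.differentiable (by simp)) (-(((k : ℝ) + 1) * t))).hasDerivAt
    have h3 := (h2.comp t h1).deriv
    rw [show g k = cutoff ∘ fun s : ℝ => -(((k : ℝ) + 1) * s) from rfl, h3]
    ring
  have hneg : ∀ x ∈ D, f x < 0 := fun x hx => by rw [hD] at hx; exact hx
  have hzero : ∀ k, ∀ x ∈ frontier D, (fun y => g k (f y)) =ᶠ[𝓝 x] 0 := by
    intro k x hx
    have hfx : f x = 0 := by rw [hfr] at hx; exact hx
    have hc : Continuous fun y => -(((k : ℝ) + 1) * f y) :=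
      (continuous_const.mul hf.continuous).neg
    filter_upwards [hc.continuousAt.eventually_lt continuousAt_const
      (show -(((k : ℝ) + 1) * f x) < 1 by simp [hfx])] with y hy
    exact cutoff_eq_zero hy.le
  have green := fun k => integral_mul_wdiv_eq_neg hDo hb ha hv ((hg k).comp hf) (hzero k)
  have hI : IntegrableOn (fun x => |wdiv a v x|) D :=
    Continuous.integrableOn_of_isBounded hb (ha.wdiv hv).continuous.abs
  have T1 : Tendsto (fun k => ∫ x in D, g k (f x) * wdiv a v x) atTop
      (𝓝 (∫ x in D, wdiv a v x)) := by
    refine tendsto_integral_of_dominated_convergence (fun x => |wdiv a v x|) (fun k => ?_) hI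
      (fun k => ?_) ?_
    · exact (((hg k).continuous.comp hf.continuous).mul
        (ha.wdiv hv).continuous).aestronglyMeasurable
    · refine Eventually.of_forall fun x => ?_
      rw [Real.norm_eq_abs, abs_mul, abs_of_nonneg (cutoff_nonneg _)]
      exact mul_le_of_le_one_left (abs_nonneg _) (cutoff_le_one _)
    · refine (ae_restrict_iff' hDo.measurableSet).2 (Eventually.of_forall fun x hx => ?_)
      refine tendsto_const_nhds.congr' ?_
      filter_upwards [eventually_two_lt_scaled (hneg x hx)] with k hk
      simp only [g, cutoff_eq_one hk.le, one_mul]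
  have T2 : Tendsto (fun k => ∫ x in D, a x * gradDot (fun y => g k (f y)) v x) atTop
      (𝓝 (∫ x in D, (0 : ℝ))) := by
    refine tendsto_integral_of_dominated_convergence (fun _ => C * C') (fun k => ?_)
      (Continuous.integrableOn_of_isBounded hb continuous_const) (fun k => ?_) ?_
    · exact (ha.mul (((hg k).comp hf).gradDot hv)).continuous.aestronglyMeasurable
    · refine (ae_restrict_iff' hDo.measurableSet).2 (Eventually.of_forall fun x hx => ?_)
      rw [gradDot_comp ((hg k).differentiable (by simp) _) (hf.differentiable (by simp) _), hg',
        Real.norm_eq_abs]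
      set y := -(((k : ℝ) + 1) * f x) with hy
      have hk : (0 : ℝ) < (k : ℝ) + 1 := by positivity
      have hyabs : |y| = ((k : ℝ) + 1) * |f x| := by
        rw [hy, abs_neg, abs_mul, abs_of_pos hk]
      calc |a x * (-(((k : ℝ) + 1) * deriv cutoff y) * gradDot f v x)|
          = (((k : ℝ) + 1) * |deriv cutoff y|) * |a x * gradDot f v x| := by
            simp only [abs_mul, abs_neg, abs_of_pos hk]; ring
        _ ≤ (((k : ℝ) + 1) * |deriv cutoff y|) * (C * |f x|) := by
            gcongr; exact hC x hx
        _ = C * |y * deriv cutoff y| := by rw [abs_mul, hyabs]; ring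
        _ ≤ C * C' := by
            have hC0 : 0 ≤ C := by
              have := (abs_nonneg _).trans (hC x hx)
              exact nonneg_of_mul_nonneg_left this (abs_pos.2 (hneg x hx).ne)
            exact mul_le_mul_of_nonneg_left (hC' y) hC0
    · refine (ae_restrict_iff' hDo.measurableSet).2 (Eventually.of_forall fun x hx => ?_)
      refine tendsto_const_nhds.congr' ?_
      filter_upwards [eventually_two_lt_scaled (hneg x hx)] with k hk
      rw [gradDot_comp ((hg k).differentiable (by simp) _) (hf.differentiable (by simp) _), hg',
        deriv_cutoff_of_gt hk]
      simp
  have T3 := T2.neg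
  simp only [integral_zero, neg_zero] at T3
  refine tendsto_nhds_unique T1 (T3.congr fun k => ?_)
  exact (green k).symm

/-- A smooth approximation of the negative part of `t`, supported in `t ≤ -1 / (k + 1)`. -/
noncomputable def smoothNegPart (k : ℕ) (t : ℝ) : ℝ := -t * cutoff (-(((k : ℝ) + 1) * t))

section SmoothNegPart

variable {k : ℕ} {t : ℝ}

theorem contDiff_smoothNegPart (k : ℕ) : ContDiff ℝ (⊤ : ℕ∞) (smoothNegPart k) :=
  contDiff_id.neg.mul (contDiff_cutoff.comp (contDiff_const.mul contDiff_id).neg)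

theorem deriv_smoothNegPart (k : ℕ) (t : ℝ) : deriv (smoothNegPart k) t =
    -(cutoff (-(((k : ℝ) + 1) * t)) +
      -(((k : ℝ) + 1) * t) * deriv cutoff (-(((k : ℝ) + 1) * t))) := by
  have h1 : HasDerivAt (fun s : ℝ => -(((k : ℝ) + 1) * s)) (-(((k : ℝ) + 1) * 1)) t :=
    ((hasDerivAt_id t).const_mul _).neg
  have h2 := ((contDiff_cutoff.differentiable (by simp)) (-(((k : ℝ) + 1) * t))).hasDerivAt
  have h3 := (((hasDerivAt_id t).neg).mul (h2.comp t h1)).deriv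
  refine h3.trans ?_
  simp only [Pi.neg_apply, id, Function.comp]
  ring

theorem exists_abs_deriv_smoothNegPart_le :
    ∃ C, 0 ≤ C ∧ ∀ k t, |deriv (smoothNegPart k) t| ≤ C := by
  obtain ⟨C, hC0, hC⟩ := exists_abs_mul_deriv_cutoff_le
  refine ⟨1 + C, by positivity, fun k t => ?_⟩
  rw [deriv_smoothNegPart, abs_neg]
  refine (abs_add_le _ _).trans (add_le_add ?_ (hC _))
  rw [abs_of_nonneg (cutoff_nonneg _)]
  exact cutoff_le_one _

theorem scaled_lt_one_of_nonneg (k : ℕ) (ht : 0 ≤ t) : -(((k : ℝ) + 1) * t) < 1 := by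
  have : 0 ≤ ((k : ℝ) + 1) * t := by positivity
  linarith

theorem smoothNegPart_of_nonneg (ht : 0 ≤ t) : smoothNegPart k t = 0 := by
  rw [smoothNegPart, cutoff_eq_zero (scaled_lt_one_of_nonneg k ht).le, mul_zero]

theorem deriv_smoothNegPart_of_nonneg (ht : 0 ≤ t) : deriv (smoothNegPart k) t = 0 := by
  rw [deriv_smoothNegPart, cutoff_eq_zero (scaled_lt_one_of_nonneg k ht).le,
    deriv_cutoff_of_lt (scaled_lt_one_of_nonneg k ht)]
  simp

theorem smoothNegPart_nonneg : 0 ≤ smoothNegPart k t := by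
  rcases le_or_gt 0 t with h | h
  · rw [smoothNegPart_of_nonneg h]
  · exact mul_nonneg (by linarith) (cutoff_nonneg _)

theorem smoothNegPart_le_abs : smoothNegPart k t ≤ |t| := by
  rcases le_or_gt 0 t with h | h
  · rw [smoothNegPart_of_nonneg h]
    exact abs_nonneg _
  · rw [abs_of_neg h]
    exact mul_le_of_le_one_right (by linarith) (cutoff_le_one _)

theorem eventually_smoothNegPart_eq (t : ℝ) :
    ∀ᶠ k : ℕ in atTop, smoothNegPart k t = -min t 0 := by
  rcases le_or_gt 0 t with h | h
  · exact Eventually.of_forall fun k => by rw [smoothNegPart_of_nonneg h, min_eq_right h, neg_zero]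
  · filter_upwards [eventually_two_lt_scaled h] with k hk
    rw [smoothNegPart, cutoff_eq_one hk.le, min_eq_left h.le, mul_one]

theorem eventually_deriv_smoothNegPart_eq (t : ℝ) :
    ∀ᶠ k : ℕ in atTop, deriv (smoothNegPart k) t = if t < 0 then -1 else 0 := by
  rcases le_or_gt 0 t with h | h
  · exact Eventually.of_forall fun k => by
      rw [deriv_smoothNegPart_of_nonneg h, if_neg (not_lt.2 h)]
  · filter_upwards [eventually_two_lt_scaled h] with k hk
    rw [deriv_smoothNegPart, cutoff_eq_one hk.le, deriv_cutoff_of_gt hk, if_pos h]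
    simp

theorem smoothNegPart_comp_eventuallyEq_zero {n : ℕ} {v : EuclideanSpace ℝ (Fin n) → ℝ}
    {x : EuclideanSpace ℝ (Fin n)} (hv : Continuous v) (hx : v x = 0) (k : ℕ) :
    (fun y => smoothNegPart k (v y)) =ᶠ[𝓝 x] 0 := by
  have hc : Continuous fun y => -(((k : ℝ) + 1) * v y) := (continuous_const.mul hv).neg
  filter_upwards [hc.continuousAt.eventually_lt continuousAt_const
    (show -(((k : ℝ) + 1) * v x) < 1 by simp [hx])] with y hy
  simp [smoothNegPart, cutoff_eq_zero hy.le]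

end SmoothNegPart

/-- A nonnegative continuous function on an open set with nonpositive integral vanishes. -/
theorem eq_zero_of_setIntegral_nonpos {n : ℕ} {D : Set (EuclideanSpace ℝ (Fin n))}
    {h : EuclideanSpace ℝ (Fin n) → ℝ} (hDo : IsOpen D) (hc : ContinuousOn h D)
    (hi : IntegrableOn h D) (h0 : ∀ x ∈ D, 0 ≤ h x) (hint : ∫ x in D, h x ≤ 0) :
    ∀ x ∈ D, h x = 0 := by
  have hae : 0 ≤ᵐ[volume.restrict D] h :=
    (ae_restrict_iff' hDo.measurableSet).2 (Eventually.of_forall h0)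
  have hz : ∫ x in D, h x = 0 := le_antisymm hint (setIntegral_nonneg hDo.measurableSet h0)
  have hz' : h =ᵐ[volume.restrict D] 0 := (integral_eq_zero_iff_of_nonneg_ae hae hi).1 hz
  exact Measure.eqOn_open_of_ae_eq hz' hDo hc continuousOn_const

/-- Weak maximum principle below the first Dirichlet eigenvalue. -/
theorem nonneg_of_wdiv_le {n : ℕ} {D : Set (EuclideanSpace ℝ (Fin n))}
    {a v ρ : EuclideanSpace ℝ (Fin n) → ℝ} {Λ μ : ℝ} (hDo : IsOpen D)
    (hb : Bornology.IsBounded D) (ha : ContDiff ℝ (⊤ : ℕ∞) a) (hv : ContDiff ℝ (⊤ : ℕ∞) v)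
    (hρ : ContinuousOn ρ (closure D)) (hρpos : ∀ x ∈ D, 0 < ρ x)
    (hbd : ∀ x ∈ frontier D, v x = 0)
    (hdiv : ∀ x ∈ D, v x < 0 → wdiv a v x ≤ -(Λ * ρ x * v x))
    (hray : ∀ F : EuclideanSpace ℝ (Fin n) → ℝ, ContDiff ℝ (⊤ : ℕ∞) F →
      (∀ x ∈ frontier D, F =ᶠ[𝓝 x] 0) →
      μ * ∫ x in D, ρ x * F x ^ 2 ≤ ∫ x in D, a x * gradDot F F x)
    (hΛ : Λ < μ) : ∀ x ∈ D, 0 ≤ v x := by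
  have hmeas := hDo.measurableSet
  obtain ⟨C, hC0, hC⟩ := exists_abs_deriv_smoothNegPart_le
  have hs : ∀ k, ContDiff ℝ (⊤ : ℕ∞) (fun y => smoothNegPart k (v y)) := fun k =>
    (contDiff_smoothNegPart k).comp hv
  have hs0 : ∀ k, ∀ x ∈ frontier D, (fun y => smoothNegPart k (v y)) =ᶠ[𝓝 x] 0 :=
    fun k x hx => smoothNegPart_comp_eventuallyEq_zero hv.continuous (hbd x hx) k
  have hds : ∀ k x, DifferentiableAt ℝ (smoothNegPart k) (v x) := fun k x =>
    (contDiff_smoothNegPart k).differentiable (by simp) _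
  have hdv : ∀ x, DifferentiableAt ℝ v x := hv.differentiable (by simp)
  have hρm : AEStronglyMeasurable ρ (volume.restrict D) :=
    (hρ.integrableOn_of_isBounded hb).aestronglyMeasurable
  have hmin : Continuous fun x => min (v x) 0 := hv.continuous.min continuous_const
  set P := ∫ x in D, ρ x * (min (v x) 0) ^ 2
  set Q := ∫ x in D, (if v x < 0 then (1 : ℝ) else 0) * (a x * gradDot v v x)
  have hIρ : IntegrableOn (fun x => |ρ x| * v x ^ 2) D :=
    ContinuousOn.integrableOn_of_isBounded hb
      (hρ.abs.mul (hv.continuous.pow 2).continuousOn)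
  have hsq : ∀ k x, |smoothNegPart k (v x)| ≤ |v x| := fun k x => by
    rw [abs_of_nonneg smoothNegPart_nonneg]
    exact smoothNegPart_le_abs
  have T1 : Tendsto (fun k => ∫ x in D, ρ x * smoothNegPart k (v x) ^ 2) atTop (𝓝 P) := by
    refine tendsto_integral_of_dominated_convergence _ (fun k => ?_) hIρ (fun k => ?_) ?_
    · exact hρm.mul ((hs k).continuous.pow 2).aestronglyMeasurable
    · refine Eventually.of_forall fun x => ?_
      rw [Real.norm_eq_abs, abs_mul, abs_pow, ← sq_abs (v x)]
      exact mul_le_mul_of_nonneg_left (pow_le_pow_left₀ (abs_nonneg _) (hsq k x) 2)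
        (abs_nonneg _)
    · refine Eventually.of_forall fun x => tendsto_const_nhds.congr' ?_
      filter_upwards [eventually_smoothNegPart_eq (v x)] with k hk
      rw [hk, neg_sq]
  have T2 : Tendsto (fun k => ∫ x in D, ρ x * (-v x * smoothNegPart k (v x))) atTop (𝓝 P) := by
    refine tendsto_integral_of_dominated_convergence _ (fun k => ?_) hIρ (fun k => ?_) ?_
    · exact hρm.mul (hv.continuous.neg.mul (hs k).continuous).aestronglyMeasurable
    · refine Eventually.of_forall fun x => ?_
      rw [Real.norm_eq_abs, abs_mul, abs_mul, abs_neg, ← sq_abs (v x), sq]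
      exact mul_le_mul_of_nonneg_left (mul_le_mul_of_nonneg_left (hsq k x) (abs_nonneg _))
        (abs_nonneg _)
    · refine Eventually.of_forall fun x => tendsto_const_nhds.congr' ?_
      filter_upwards [eventually_smoothNegPart_eq (v x)] with k hk
      rw [hk]
      rcases le_or_gt 0 (v x) with h | h
      · simp [min_eq_right h]
      · rw [min_eq_left h.le]; ring
  have T3 : Tendsto (fun k => ∫ x in D, a x * gradDot (fun y => smoothNegPart k (v y))
      (fun y => smoothNegPart k (v y)) x) atTop (𝓝 Q) := by
    refine tendsto_integral_of_dominated_convergence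
      (fun x => C ^ 2 * |a x * gradDot v v x|) (fun k => ?_)
      (Continuous.integrableOn_of_isBounded hb
        (continuous_const.mul (ha.mul (hv.gradDot hv)).continuous.abs)) (fun k => ?_) ?_
    · exact (ha.mul ((hs k).gradDot (hs k))).continuous.aestronglyMeasurable
    · refine Eventually.of_forall fun x => ?_
      rw [gradDot_self_comp (hds k x) (hdv x), mul_left_comm, Real.norm_eq_abs, abs_mul, abs_pow]
      gcongr
      exact hC k _
    · refine Eventually.of_forall fun x => tendsto_const_nhds.congr' ?_
      filter_upwards [eventually_deriv_smoothNegPart_eq (v x)] with k hk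
      rw [gradDot_self_comp (hds k x) (hdv x), hk]
      split_ifs <;> ring
  have T4 : Tendsto (fun k => ∫ x in D, -(a x * gradDot (fun y => smoothNegPart k (v y)) v x))
      atTop (𝓝 Q) := by
    refine tendsto_integral_of_dominated_convergence
      (fun x => C * |a x * gradDot v v x|) (fun k => ?_)
      (Continuous.integrableOn_of_isBounded hb
        (continuous_const.mul (ha.mul (hv.gradDot hv)).continuous.abs)) (fun k => ?_) ?_
    · exact (ha.mul ((hs k).gradDot hv)).continuous.neg.aestronglyMeasurable
    · refine Eventually.of_forall fun x => ?_
      rw [gradDot_comp (hds k x) (hdv x), mul_left_comm, Real.norm_eq_abs, abs_neg, abs_mul]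
      gcongr
      exact hC k _
    · refine Eventually.of_forall fun x => tendsto_const_nhds.congr' ?_
      filter_upwards [eventually_deriv_smoothNegPart_eq (v x)] with k hk
      rw [gradDot_comp (hds k x) (hdv x), hk]
      split_ifs <;> ring
  have hlow : μ * P ≤ Q := le_of_tendsto_of_tendsto' (T1.const_mul μ) T3 fun k =>
    hray _ (hs k) (hs0 k)
  have hup : Q ≤ Λ * P := by
    refine le_of_tendsto_of_tendsto' T4 (T2.const_mul Λ) fun k => ?_
    rw [integral_neg, ← integral_mul_wdiv_eq_neg hDo hb ha hv (hs k) (hs0 k),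
      ← integral_const_mul]
    refine setIntegral_mono_on (Continuous.integrableOn_of_isBounded hb
      ((hs k).mul (ha.wdiv hv)).continuous) ?_ hmeas fun x hx => ?_
    · exact ContinuousOn.integrableOn_of_isBounded hb (continuousOn_const.mul
        (hρ.mul (hv.continuous.neg.mul (hs k).continuous).continuousOn))
    · rcases le_or_gt 0 (v x) with h | h
      · simp [smoothNegPart_of_nonneg h]
      · calc smoothNegPart k (v x) * wdiv a v x
            ≤ smoothNegPart k (v x) * -(Λ * ρ x * v x) :=
              mul_le_mul_of_nonneg_left (hdiv x hx h) smoothNegPart_nonneg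
          _ = Λ * (ρ x * (-v x * smoothNegPart k (v x))) := by ring
  have hPpos : ∀ x ∈ D, 0 ≤ ρ x * (min (v x) 0) ^ 2 := fun x hx =>
    mul_nonneg (hρpos x hx).le (sq_nonneg _)
  have hP0 : P ≤ 0 := by
    by_contra h
    nlinarith [not_le.1 h]
  have hcP : ContinuousOn (fun x => ρ x * (min (v x) 0) ^ 2) (closure D) :=
    hρ.mul (hmin.pow 2).continuousOn
  have hz := eq_zero_of_setIntegral_nonpos hDo (hcP.mono subset_closure)
    (hcP.integrableOn_of_isBounded hb) hPpos hP0
  intro x hx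
  have h1 : min (v x) 0 = 0 := by
    have := hz x hx
    simpa [(hρpos x hx).ne'] using this
  exact min_eq_right_iff.1 h1

/-- The Rayleigh quotient bound for smooth functions vanishing near the boundary. -/
theorem lam1_mul_integral_le {n : ℕ} {D : Set (EuclideanSpace ℝ (Fin n))}
    {w F : EuclideanSpace ℝ (Fin n) → ℝ} (hDo : IsOpen D) (hb : Bornology.IsBounded D)
    (hw : ∀ x ∈ D, 0 < w x) (hFs : ContDiff ℝ (⊤ : ℕ∞) F)
    (hF : ∀ x ∈ frontier D, F =ᶠ[𝓝 x] 0) :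
    lam1 n D w * ∫ x in D, (w x) ^ ((2 * (n : ℝ)) / ((n : ℝ) - 2)) * F x ^ 2 ≤
      ∫ x in D, (w x) ^ 2 * gradDot F F x := by
  have hden : ∀ φ : EuclideanSpace ℝ (Fin n) → ℝ,
      0 ≤ ∫ x in D, (w x) ^ ((2 * (n : ℝ)) / ((n : ℝ) - 2)) * φ x ^ 2 := fun φ =>
    setIntegral_nonneg hDo.measurableSet fun x hx =>
      mul_nonneg (Real.rpow_nonneg (hw x hx).le _) (sq_nonneg _)
  have hnum : ∀ φ : EuclideanSpace ℝ (Fin n) → ℝ,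
      0 ≤ ∫ x in D, (w x) ^ 2 * ‖gradient φ x‖ ^ 2 := fun φ =>
    integral_nonneg fun x => by positivity
  have e1 : ∫ x in D, (w x) ^ ((2 * (n : ℝ)) / ((n : ℝ) - 2)) * D.indicator F x ^ 2 =
      ∫ x in D, (w x) ^ ((2 * (n : ℝ)) / ((n : ℝ) - 2)) * F x ^ 2 :=
    setIntegral_congr_fun hDo.measurableSet fun x hx => by simp [hx]
  have e2 : ∫ x in D, (w x) ^ 2 * ‖gradient (D.indicator F) x‖ ^ 2 =
      ∫ x in D, (w x) ^ 2 * gradDot F F x :=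
    setIntegral_congr_fun hDo.measurableSet fun x hx => by
      simp only [norm_gradient_sq, gradDot,
        fun i => partialD_congr (indicator_eventuallyEq_self (F := F) hDo hx) i]
  rcases (hden F).eq_or_lt with h | h
  · rw [← h, mul_zero, ← e2]
    exact hnum _
  · rw [← le_div_iff₀ h, ← e1, ← e2]
    refine csInf_le ⟨0, ?_⟩ ⟨D.indicator F, hFs.indicator_of_frontier hF hDo,
      hasCompactSupport_indicator hb, tsupport_indicator_subset_of_frontier hF hDo, ?_, rfl⟩
    · rintro q ⟨φ, -, -, -, -, rfl⟩
      exact div_nonneg (hnum φ) (hden φ)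
    · intro h0
      rw [← e1, h0] at h
      simp at h

/-- Linearization of the conformal scalar curvature inequality. -/
theorem wdiv_le_of_Rcurv_le {n : ℕ} (hn : 3 ≤ n) {w u : EuclideanSpace ℝ (Fin n) → ℝ}
    {x : EuclideanSpace ℝ (Fin n)} (hw : ContDiff ℝ (⊤ : ℕ∞) w) (hu : ContDiff ℝ (⊤ : ℕ∞) u)
    (hwx : 0 < w x) (hux : 0 < u x) (hR : 0 < Rcurv n w x)
    (h : Rcurv n w x ≤ Rcurv n (fun y => w y * u y) x) :
    wdiv (fun y => w y ^ 2) u x ≤ -(Rcurv n w x / ((n : ℝ) - 1) *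
      (w x) ^ ((2 * (n : ℝ)) / ((n : ℝ) - 2)) * (u x - 1)) := by
  have hn' : (3 : ℝ) ≤ n := by exact_mod_cast hn
  have hn1 : (0 : ℝ) < (n : ℝ) - 1 := by linarith
  have hn2 : (0 : ℝ) < (n : ℝ) - 2 := by linarith
  set p : ℝ := ((n : ℝ) + 2) / ((n : ℝ) - 2) with hp
  set c : ℝ := 4 * ((n : ℝ) - 1) / ((n : ℝ) - 2) with hc
  have hcpos : 0 < c := by positivity
  have hp1 : 1 ≤ p := by rw [hp, le_div_iff₀ hn2]; linarith
  have hpc : p - 1 = c / ((n : ℝ) - 1) := by rw [hp, hc]; field_simp; ring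
  have hexp : (2 * (n : ℝ)) / ((n : ℝ) - 2) = p + 1 := by rw [hp]; field_simp; ring
  set R := Rcurv n w x with hRdef
  have hRw : R * (w x) ^ p = -c * lap w x := by
    rw [hRdef, Rcurv, Real.rpow_neg hwx.le]
    have := (Real.rpow_pos_of_pos hwx p).ne'
    rw [← hp, ← hc]
    field_simp
  have hwu : 0 < w x * u x := mul_pos hwx hux
  have hRwu : R * ((w x) ^ p * (u x) ^ p) ≤ -c * lap (fun y => w y * u y) x := by
    rw [← Real.mul_rpow hwx.le hux.le]
    have hpos := Real.rpow_pos_of_pos hwu p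
    calc R * (w x * u x) ^ p ≤ Rcurv n (fun y => w y * u y) x * (w x * u x) ^ p := by gcongr
      _ = -c * lap (fun y => w y * u y) x := by
        rw [Rcurv, Real.rpow_neg hwu.le, ← hp, ← hc]
        field_simp
  have hbern : 1 + p * (u x - 1) ≤ (u x) ^ p := by
    have := one_add_mul_self_le_rpow_one_add (s := u x - 1) (by linarith) hp1
    simpa using this
  rw [wdiv_sq_eq hw hu, hexp, Real.rpow_add_one hwx.ne']
  set W := (w x) ^ p with hW
  have hWpos : 0 < W := Real.rpow_pos_of_pos hwx p
  refine le_of_mul_le_mul_left ?_ hcpos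
  have k1 : c * (w x * lap (fun y => w y * u y) x - u x * w x * lap w x) ≤
      -(w x * (R * (W * u x ^ p))) + u x * w x * (R * W) := by
    rw [hRw]
    have := mul_le_mul_of_nonneg_left hRwu hwx.le
    linarith
  have k2 : 0 ≤ R * W * w x * (u x ^ p - u x - (p - 1) * (u x - 1)) :=
    mul_nonneg (by positivity) (by linarith)
  have k3 : c * -(R / ((n : ℝ) - 1) * (W * w x) * (u x - 1)) =
      -(R * W * w x * ((p - 1) * (u x - 1))) := by
    rw [hpc]; ring
  rw [k3]
  linarith

theorem wdiv_sub_const {n : ℕ} {a u : EuclideanSpace ℝ (Fin n) → ℝ} (c : ℝ)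
    (x : EuclideanSpace ℝ (Fin n)) : wdiv a (fun y => u y - c) x = wdiv a u x := by
  simp [wdiv, partialD, fderiv_sub_const]

theorem ContinuousOn.Rcurv {n : ℕ} {w : EuclideanSpace ℝ (Fin n) → ℝ}
    {s : Set (EuclideanSpace ℝ (Fin n))} (hw : ContDiff ℝ (⊤ : ℕ∞) w) (hpos : ∀ x ∈ s, 0 < w x) :
    ContinuousOn (Rcurv n w) s :=
  (continuousOn_const.mul (hw.continuous.continuousOn.rpow_const fun x hx =>
    Or.inl (hpos x hx).ne')).mul hw.lap.continuous.continuousOn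

/-- Conformally flat case of Theorem 2.2: if `R[w] > 0` on `closure D`,
`λ₁(D,w) > (sup_D R[w])/(n-1)`, `R[w·u] ≥ R[w]` on `D`, `u = 1` on `∂D` and
`∂u/∂ν = 0` on `∂D`, then `u ≡ 1` on `D`. -/
theorem stmt_9 (n : ℕ) (hn : 3 ≤ n)
    (D : Set (EuclideanSpace ℝ (Fin n))) (hDo : IsOpen D)
    (hDb : Bornology.IsBounded D)
    (ν : EuclideanSpace ℝ (Fin n) → EuclideanSpace ℝ (Fin n))
    (hsb : SmoothBoundaryNormal D ν)
    (w : EuclideanSpace ℝ (Fin n) → ℝ)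
    (U : Set (EuclideanSpace ℝ (Fin n)))
    (hU : IsOpen U) (hUc : closure D ⊆ U)
    (hw : ContDiffOn ℝ (⊤ : ℕ∞) w U) (hwpos : ∀ x ∈ U, 0 < w x)
    (hRpos : ∀ x ∈ closure D, 0 < Rcurv n w x)
    (hlam : sSup ((fun x => Rcurv n w x) '' D) / ((n : ℝ) - 1) < lam1 n D w)
    (u : EuclideanSpace ℝ (Fin n) → ℝ)
    (V : Set (EuclideanSpace ℝ (Fin n)))
    (hV : IsOpen V) (hVc : closure D ⊆ V)
    (hu : ContDiffOn ℝ (⊤ : ℕ∞) u V) (hupos : ∀ x ∈ V, 0 < u x)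
    (hcurv : ∀ x ∈ D, Rcurv n w x ≤ Rcurv n (fun y => w y * u y) x)
    (hbd1 : ∀ x ∈ frontier D, u x = 1)
    (hbd2 : ∀ x ∈ frontier D, fderiv ℝ u x (ν x) = 0) :
    ∀ x ∈ D, u x = 1 := by
  obtain ⟨f, hf, hDf, hfr, hnormal⟩ := hsb
  obtain ⟨w', hw', hww⟩ := exists_contDiff_eventuallyEq isClosed_closure hU hUc hw
  obtain ⟨u', hu', huu⟩ := exists_contDiff_eventuallyEq isClosed_closure hV hVc hu
  have hn' : (3 : ℝ) ≤ n := by exact_mod_cast hn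
  have hn1 : (0 : ℝ) < (n : ℝ) - 1 := by linarith
  have hwx : ∀ x ∈ closure D, w' x = w x := fun x hx => (hww x hx).eq_of_nhds
  have hux : ∀ x ∈ closure D, u' x = u x := fun x hx => (huu x hx).eq_of_nhds
  have hw'pos : ∀ x ∈ closure D, 0 < w' x := fun x hx => by
    rw [hwx x hx]; exact hwpos x (hUc hx)
  have hu'pos : ∀ x ∈ closure D, 0 < u' x := fun x hx => by
    rw [hux x hx]; exact hupos x (hVc hx)
  have hRw : ∀ x ∈ closure D, Rcurv n w' x = Rcurv n w x := fun x hx => Rcurv_congr (hww x hx)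
  have hRwu : ∀ x ∈ closure D, Rcurv n (fun y => w' y * u' y) x =
      Rcurv n (fun y => w y * u y) x := fun x hx => Rcurv_congr ((hww x hx).mul (huu x hx))
  have hRc : ContinuousOn (Rcurv n w') (closure D) := ContinuousOn.Rcurv hw' hw'pos
  set ρ : EuclideanSpace ℝ (Fin n) → ℝ := fun x => (w' x) ^ ((2 * (n : ℝ)) / ((n : ℝ) - 2)) with hρ
  have hρpos : ∀ x ∈ closure D, 0 < ρ x := fun x hx => Real.rpow_pos_of_pos (hw'pos x hx) _
  have hρc : ContinuousOn ρ (closure D) :=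
    hw'.continuous.continuousOn.rpow_const fun x hx => Or.inl (hw'pos x hx).ne'
  have ha : ContDiff ℝ (⊤ : ℕ∞) fun y => w' y ^ 2 := hw'.pow 2
  set v : EuclideanSpace ℝ (Fin n) → ℝ := fun x => u' x - 1 with hvdef
  have hv : ContDiff ℝ (⊤ : ℕ∞) v := hu'.sub contDiff_const
  have hdiv : ∀ x ∈ D, wdiv (fun y => w' y ^ 2) v x ≤
      -(Rcurv n w' x / ((n : ℝ) - 1) * ρ x * v x) := by
    intro x hx
    have hxc := subset_closure hx
    rw [hvdef, wdiv_sub_const]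
    refine wdiv_le_of_Rcurv_le hn hw' hu' (hw'pos x hxc) (hu'pos x hxc) ?_ ?_
    · rw [hRw x hxc]; exact hRpos x hxc
    · rw [hRw x hxc, hRwu x hxc]; exact hcurv x hx
  have hbdd : BddAbove ((fun x => Rcurv n w x) '' D) := by
    obtain ⟨M, hM⟩ := hDb.isCompact_closure.bddAbove_image hRc
    refine ⟨M, ?_⟩
    rintro _ ⟨x, hx, rfl⟩
    have := hM (mem_image_of_mem _ (subset_closure hx))
    rwa [hRw x (subset_closure hx)] at this
  have hlam' : lam1 n D w' = lam1 n D w := by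
    have e1 : ∀ φ : EuclideanSpace ℝ (Fin n) → ℝ,
        ∫ x in D, (w' x) ^ 2 * ‖gradient φ x‖ ^ 2 = ∫ x in D, (w x) ^ 2 * ‖gradient φ x‖ ^ 2 :=
      fun φ => setIntegral_congr_fun hDo.measurableSet fun x hx => by
        simp only [hwx x (subset_closure hx)]
    have e2 : ∀ φ : EuclideanSpace ℝ (Fin n) → ℝ,
        ∫ x in D, (w' x) ^ ((2 * (n : ℝ)) / ((n : ℝ) - 2)) * φ x ^ 2 =
          ∫ x in D, (w x) ^ ((2 * (n : ℝ)) / ((n : ℝ) - 2)) * φ x ^ 2 :=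
      fun φ => setIntegral_congr_fun hDo.measurableSet fun x hx => by
        simp only [hwx x (subset_closure hx)]
    simp only [lam1, e1, e2]
  have hfrc : ∀ x ∈ frontier D, x ∈ closure D := fun x hx => frontier_subset_closure hx
  have hv0 : ∀ x ∈ frontier D, v x = 0 := fun x hx => by
    simp only [hvdef, hux x (hfrc x hx), hbd1 x hx, sub_self]
  have hvnn : ∀ x ∈ D, 0 ≤ v x := by
    refine nonneg_of_wdiv_le hDo hDb ha hv hρc (fun x hx => hρpos x (subset_closure hx)) hv0
      (fun x hx hvx => (hdiv x hx).trans ?_)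
      (fun F hF hF0 => lam1_mul_integral_le hDo hDb
        (fun x hx => hw'pos x (subset_closure hx)) hF hF0) (hlam'.symm ▸ hlam)
    have hle : Rcurv n w' x ≤ sSup ((fun x => Rcurv n w x) '' D) := by
      rw [hRw x (subset_closure hx)]
      exact le_csSup hbdd (mem_image_of_mem _ hx)
    have h1 : Rcurv n w' x / ((n : ℝ) - 1) * ρ x ≤
        sSup ((fun x => Rcurv n w x) '' D) / ((n : ℝ) - 1) * ρ x :=
      mul_le_mul_of_nonneg_right (div_le_div_of_nonneg_right hle hn1.le)
        (hρpos x (subset_closure hx)).le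
    exact neg_le_neg (mul_le_mul_of_nonpos_right h1 hvx.le)
  have hgrad0 : ∀ x ∈ frontier D, gradDot f v x = 0 := by
    intro x hx
    obtain ⟨hne, hνx⟩ := hnormal x hx
    have h1 := hbd2 x hx
    rw [hνx, map_smul, smul_eq_mul, ← (huu x (hfrc x hx)).fderiv_eq] at h1
    rw [← fderiv_apply_gradient, hvdef, fderiv_sub_const]
    exact (mul_eq_zero.1 h1).resolve_left (inv_ne_zero (norm_ne_zero_iff.2 hne))
  have hint := integral_wdiv_eq_zero hDo hDb ha hv hf hDf hfr (fun x hx => (hnormal x hx).1) hgrad0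
  have hqc : ContinuousOn (fun x => Rcurv n w' x / ((n : ℝ) - 1) * ρ x * v x) (closure D) :=
    ((hRc.div_const _).mul hρc).mul hv.continuous.continuousOn
  have hR' : ∀ x ∈ D, 0 < Rcurv n w' x / ((n : ℝ) - 1) * ρ x := fun x hx => by
    have hxc := subset_closure hx
    refine mul_pos (div_pos ?_ hn1) (hρpos x hxc)
    rw [hRw x hxc]
    exact hRpos x hxc
  have hzero := eq_zero_of_setIntegral_nonpos hDo (hqc.mono subset_closure)
    (hqc.integrableOn_of_isBounded hDb)
    (fun x hx => mul_nonneg (hR' x hx).le (hvnn x hx)) (by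
      have := setIntegral_mono_on (Continuous.integrableOn_of_isBounded hDb
        (ha.wdiv hv).continuous) (hqc.integrableOn_of_isBounded hDb).neg hDo.measurableSet hdiv
      rw [hint] at this
      simp only [Pi.neg_apply, integral_neg] at this
      linarith)
  intro x hx
  have h1 := (mul_eq_zero.1 (hzero x hx)).resolve_left (hR' x hx).ne'
  have h2 : u' x - 1 = 0 := h1
  rw [← hux x (subset_closure hx)]
  linarith
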